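/- Let α ∈ (0,1/2), let X₁,…,Xₙ be integrable, each non-degenerate, and set xᵢ = ex_α(Xᵢ). Let Δₙ = {w ∈ [0,1]ⁿ : w₁+⋯+wₙ = 1}. For w ∈ Δₙ define g(w) = E[(Σᵢ wᵢ(Xᵢ − xᵢ))₊] / E[Σᵢ wᵢ(xᵢ − Xᵢ)] (the denominator is strictly positive for every w ∈ Δₙ). Then for every w ∈ Δₙ, DQ^ex_α(w₁X₁,…,wₙXₙ) = (1/α)·g(w)/(2·g(w) + 1); consequently, w* ∈ Δₙ minimizes DQ^ex_α(w₁X₁,…,wₙXₙ) over Δₙ if and only if w* minimizes g over Δₙ. -/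

import Mathlib

open MeasureTheory

variable {Ω : Type*} [MeasurableSpace Ω]

/-- `t` is the `α`-expectile of `X` under `P`:
`(1−α)·E[(X−t)₊] = α·E[(X−t)₋]`. -/
def IsExpectile (P : Measure Ω) (α : ℝ) (X : Ω → ℝ) (t : ℝ) : Prop :=
  (1 - α) * ∫ ω, max (X ω - t) 0 ∂P = α * ∫ ω, max (t - X ω) 0 ∂P

/-- The expectile-based diversification quotient `DQ^ex_α(X₁,…,Xₙ) = α*/α`, where
`α* = inf {β ∈ (0,1) : ex_β(∑ᵢ Xᵢ) ≤ ∑ᵢ ex_α(Xᵢ)}` with the convention `inf ∅ = 1`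
(implemented by adjoining `1` to the set, which does not change a nonempty infimum since
the set, when nonempty, has infimum at most `1`). Here `ex` is the expectile functional. -/
noncomputable def DQex (P : Measure Ω) (ex : ℝ → (Ω → ℝ) → ℝ) (α : ℝ)
    {n : ℕ} (X : Fin n → Ω → ℝ) : ℝ :=
  sInf ({β : ℝ | β ∈ Set.Ioo (0:ℝ) 1 ∧
      ex β (fun ω => ∑ i, X i ω) ≤ ∑ i, ex α (X i)} ∪ {1}) / α



lemma phi_strict (P : Measure Ω) [IsProbabilityMeasure P] {β : ℝ} (hβ : β ∈ Set.Ioo (0:ℝ) 1)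
    {Y : Ω → ℝ} (hY : Integrable Y P) {s t : ℝ} (hst : s < t) :
    (1 - β) * (∫ ω, max (Y ω - t) 0 ∂P) - β * ∫ ω, max (t - Y ω) 0 ∂P <
    (1 - β) * (∫ ω, max (Y ω - s) 0 ∂P) - β * ∫ ω, max (s - Y ω) 0 ∂P := by
  obtain ⟨h0, h1⟩ := hβ
  have ip : ∀ r : ℝ, Integrable (fun ω => (1 - β) * max (Y ω - r) 0) P := fun r =>
    ((hY.sub (integrable_const r)).pos_part).const_mul _
  have im : ∀ r : ℝ, Integrable (fun ω => β * max (r - Y ω) 0) P := fun r =>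
    (((integrable_const r).sub hY).pos_part).const_mul _
  have e : ∀ r : ℝ, (1 - β) * (∫ ω, max (Y ω - r) 0 ∂P) - β * ∫ ω, max (r - Y ω) 0 ∂P
      = ∫ ω, ((1 - β) * max (Y ω - r) 0 - β * max (r - Y ω) 0) ∂P := by
    intro r
    rw [integral_sub (ip r) (im r), integral_const_mul, integral_const_mul]
  rw [e, e]
  have hc : 0 < min β (1 - β) * (t - s) :=
    mul_pos (lt_min h0 (by linarith)) (by linarith)
  have key : ∫ ω, (((1 - β) * max (Y ω - t) 0 - β * max (t - Y ω) 0) + min β (1 - β) * (t - s)) ∂P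
      ≤ ∫ ω, ((1 - β) * max (Y ω - s) 0 - β * max (s - Y ω) 0) ∂P := by
    apply integral_mono (((ip t).sub (im t)).add (integrable_const _)) ((ip s).sub (im s))
    intro ω
    simp only [Pi.add_apply, Pi.sub_apply]
    have m1 := min_le_left β (1 - β)
    have m2 := min_le_right β (1 - β)
    generalize min β (1 - β) = m at *
    rcases le_total (Y ω) s with h | h
    · rw [max_eq_right (by linarith : Y ω - t ≤ 0), max_eq_right (by linarith : Y ω - s ≤ 0),
        max_eq_left (by linarith : 0 ≤ t - Y ω), max_eq_left (by linarith : 0 ≤ s - Y ω)]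
      nlinarith
    · rcases le_total (Y ω) t with h' | h'
      · rw [max_eq_right (by linarith : Y ω - t ≤ 0), max_eq_left (by linarith : 0 ≤ Y ω - s),
          max_eq_left (by linarith : 0 ≤ t - Y ω), max_eq_right (by linarith : s - Y ω ≤ 0)]
        nlinarith
      · rw [max_eq_left (by linarith : 0 ≤ Y ω - t), max_eq_left (by linarith : 0 ≤ Y ω - s),
          max_eq_right (by linarith : t - Y ω ≤ 0), max_eq_right (by linarith : s - Y ω ≤ 0)]
        nlinarith
  have it : Integrable (fun ω => (1 - β) * max (Y ω - t) 0 - β * max (t - Y ω) 0) P :=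
    (ip t).sub (im t)
  rw [integral_add it (integrable_const _)] at key
  simp only [integral_const, probReal_univ, one_smul] at key
  linarith

lemma expectile_le_iff (P : Measure Ω) [IsProbabilityMeasure P] {β : ℝ}
    (hβ : β ∈ Set.Ioo (0:ℝ) 1)
    {Y : Ω → ℝ} (hY : Integrable Y P) {e t : ℝ} (he : IsExpectile P β Y e) :
    e ≤ t ↔ (1 - β) * (∫ ω, max (Y ω - t) 0 ∂P) ≤ β * ∫ ω, max (t - Y ω) 0 ∂P := by
  unfold IsExpectile at he
  constructor
  · intro h
    rcases h.eq_or_lt with h | h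
    · subst h; exact he.le
    · have := phi_strict P hβ hY h
      linarith
  · intro h
    by_contra hc
    have := phi_strict P hβ hY (not_le.1 hc)
    linarith

lemma expectile_unique (P : Measure Ω) [IsProbabilityMeasure P] {β : ℝ}
    (hβ : β ∈ Set.Ioo (0:ℝ) 1)
    {Y : Ω → ℝ} (hY : Integrable Y P) {e t : ℝ} (he : IsExpectile P β Y e)
    (ht : IsExpectile P β Y t) : e = t :=
  le_antisymm ((expectile_le_iff P hβ hY he).2 (le_of_eq ht))
    ((expectile_le_iff P hβ hY ht).2 (le_of_eq he))

lemma expectile_smul (P : Measure Ω) {β : ℝ} {Y : Ω → ℝ} {e c : ℝ} (hc : 0 ≤ c)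
    (he : IsExpectile P β Y e) : IsExpectile P β (fun ω => c * Y ω) (c * e) := by
  unfold IsExpectile at *
  have h : ∀ a b : ℝ, max (c * a - c * b) 0 = c * max (a - b) 0 := by
    intro a b
    rw [mul_max_of_nonneg _ _ hc]; ring_nf
  simp only [h, integral_const_mul]
  linear_combination c * he

lemma pos_sub_neg (P : Measure Ω) {Z : Ω → ℝ} (hZ : Integrable Z P) :
    ∫ ω, Z ω ∂P = (∫ ω, max (Z ω) 0 ∂P) - ∫ ω, max (-Z ω) 0 ∂P := by
  rw [← integral_sub hZ.pos_part hZ.neg_part]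
  congr 1; ext ω
  rcases le_total (Z ω) 0 with h | h
  · rw [max_eq_right h, max_eq_left (by linarith)]; ring
  · rw [max_eq_left h, max_eq_right (by linarith)]; ring

lemma expectile_mean (P : Measure Ω) [IsProbabilityMeasure P] {α : ℝ}
    (hα : α ∈ Set.Ioo (0:ℝ) (1/2)) {Y : Ω → ℝ} (hY : Integrable Y P)
    (hnd : ¬ ∃ c : ℝ, ∀ᵐ ω ∂P, Y ω = c) {e : ℝ} (he : IsExpectile P α Y e) :
    0 < ∫ ω, (e - Y ω) ∂P := by
  obtain ⟨h0, h1⟩ := hα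
  have i1 : Integrable (fun ω => e - Y ω) P := (integrable_const e).sub hY
  have hs := pos_sub_neg P i1
  simp only [neg_sub] at hs
  unfold IsExpectile at he
  have a0 : 0 ≤ ∫ ω, max (Y ω - e) 0 ∂P := integral_nonneg fun ω => le_max_right _ _
  have b0 : 0 ≤ ∫ ω, max (e - Y ω) 0 ∂P := integral_nonneg fun ω => le_max_right _ _
  by_contra hc
  have hb : ∫ ω, max (e - Y ω) 0 ∂P = 0 := by nlinarith
  have ha : ∫ ω, max (Y ω - e) 0 ∂P = 0 := by nlinarith
  apply hnd
  refine ⟨e, ?_⟩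
  have i2 : Integrable (fun ω => Y ω - e) P := hY.sub (integrable_const e)
  replace hb := (integral_eq_zero_iff_of_nonneg (fun ω => le_max_right (e - Y ω) 0) i1.pos_part).1 hb
  replace ha := (integral_eq_zero_iff_of_nonneg (fun ω => le_max_right (Y ω - e) 0) i2.pos_part).1 ha
  filter_upwards [ha, hb] with ω h2 h3
  simp only [Pi.zero_apply] at h2 h3
  have := le_max_left (Y ω - e) 0
  have := le_max_left (e - Y ω) 0
  linarith

/-- on the simplex Δₙ, DQ^ex_α(w ⊙ X) = (1/α)·g(w)/(2g(w)+1) where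
g(w) = E[(wᵀ(X−x))₊]/E[wᵀ(x−X)], whose denominator is strictly positive on Δₙ;
consequently w* minimizes DQ^ex_α over Δₙ iff it minimizes g over Δₙ. -/
theorem stmt10
    (P : Measure Ω) [IsProbabilityMeasure P]
    (α : ℝ) (hα : α ∈ Set.Ioo (0:ℝ) (1/2))
    {n : ℕ} (X : Fin n → Ω → ℝ) (hX : ∀ i, Integrable (X i) P)
    (hXnd : ∀ i, ¬ ∃ c : ℝ, ∀ᵐ ω ∂P, X i ω = c)
    (ex : ℝ → (Ω → ℝ) → ℝ)
    (hex : ∀ β ∈ Set.Ioo (0:ℝ) 1, ∀ Y : Ω → ℝ, Integrable Y P → IsExpectile P β Y (ex β Y))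
    (x : Fin n → ℝ) (hx : ∀ i, x i = ex α (X i))
    (Delta : Set (Fin n → ℝ))
    (hDelta : Delta = {w | (∀ i, 0 ≤ w i ∧ w i ≤ 1) ∧ ∑ i, w i = 1})
    (g : (Fin n → ℝ) → ℝ)
    (hg : ∀ w, g w = (∫ ω, max (∑ i, w i * (X i ω - x i)) 0 ∂P) /
        (∫ ω, ∑ i, w i * (x i - X i ω) ∂P)) :
    (∀ w ∈ Delta, 0 < ∫ ω, ∑ i, w i * (x i - X i ω) ∂P) ∧
    (∀ w ∈ Delta, DQex P ex α (fun i ω => w i * X i ω)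
        = (1 / α) * (g w / (2 * g w + 1))) ∧
    (∀ w ∈ Delta,
      ((∀ u ∈ Delta, DQex P ex α (fun i ω => w i * X i ω)
          ≤ DQex P ex α (fun i ω => u i * X i ω)) ↔
       (∀ u ∈ Delta, g w ≤ g u))) := by
  have hα' : α ∈ Set.Ioo (0:ℝ) 1 := ⟨hα.1, by linarith [hα.2]⟩
  have hpos : ∀ w ∈ Delta, 0 < ∫ ω, ∑ i, w i * (x i - X i ω) ∂P := by
    intro w hw
    rw [hDelta] at hw
    obtain ⟨hw0, hw1⟩ := hw
    have hi : ∀ i ∈ Finset.univ, Integrable (fun ω => w i * (x i - X i ω)) P :=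
      fun i _ => ((integrable_const (x i)).sub (hX i)).const_mul (w i)
    rw [integral_finsetSum _ hi]
    have hm : ∀ i, 0 < ∫ ω, (x i - X i ω) ∂P := fun i =>
      expectile_mean P hα (hX i) (hXnd i) (by rw [hx]; exact hex α hα' _ (hX i))
    simp only [integral_const_mul]
    have hex1 : ∃ i ∈ Finset.univ, 0 < w i := by
      by_contra hc
      push Not at hc
      have := Finset.sum_nonpos hc
      linarith
    obtain ⟨i, hi, hwi⟩ := hex1
    exact Finset.sum_pos' (fun j _ => mul_nonneg (hw0 j).1 (hm j).le) ⟨i, hi, mul_pos hwi (hm i)⟩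
  have hg0 : ∀ w ∈ Delta, 0 ≤ g w := by
    intro w hw
    rw [hg]
    exact div_nonneg (integral_nonneg fun ω => le_max_right _ _) (hpos w hw).le
  have hDQ : ∀ w ∈ Delta, DQex P ex α (fun i ω => w i * X i ω)
        = (1 / α) * (g w / (2 * g w + 1)) := by
    intro w hw
    have hD := hpos w hw
    have hgw := hg w
    rw [hDelta] at hw
    obtain ⟨hw0, hw1⟩ := hw
    have hexw : ∀ i, ex α (fun ω => w i * X i ω) = w i * x i := by
      intro i
      refine expectile_unique P hα' ((hX i).const_mul (w i)) (hex α hα' _ ((hX i).const_mul (w i))) ?_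
      rw [hx]
      exact expectile_smul P (hw0 i).1 (hex α hα' _ (hX i))
    have hY : Integrable (fun ω => ∑ i, w i * X i ω) P :=
      integrable_finsetSum _ fun i _ => (hX i).const_mul (w i)
    have hS : ∀ ω, ∑ i, w i * (X i ω - x i) = ∑ i, w i * X i ω - ∑ i, w i * x i := by
      intro ω; rw [← Finset.sum_sub_distrib]; simp only [mul_sub]
    have hS' : ∀ ω, ∑ i, w i * (x i - X i ω) = ∑ i, w i * x i - ∑ i, w i * X i ω := by
      intro ω; rw [← Finset.sum_sub_distrib]; simp only [mul_sub]
    simp only [hS, hS'] at hD hgw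
    have hs := pos_sub_neg P ((integrable_const (∑ i, w i * x i)).sub hY)
    simp only [Pi.sub_apply, neg_sub] at hs
    have hA0 : 0 ≤ ∫ ω, max (∑ i, w i * X i ω - ∑ i, w i * x i) 0 ∂P :=
      integral_nonneg fun ω => le_max_right _ _
    have hiff : ∀ β ∈ Set.Ioo (0:ℝ) 1, (ex β (fun ω => ∑ i, w i * X i ω) ≤ ∑ i, w i * x i ↔ _) :=
      fun β hβ => expectile_le_iff P hβ hY (t := ∑ i, w i * x i) (hex β hβ _ hY)
    simp only [DQex, hexw]
    rw [hs] at hD hgw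
    generalize (∫ ω, max (∑ i, w i * X i ω - ∑ i, w i * x i) 0 ∂P) = A at *
    generalize (∫ ω, max (∑ i, w i * x i - ∑ i, w i * X i ω) 0 ∂P) = B at *
    have hAB : 0 < A + B := by linarith
    have hgv : g w / (2 * g w + 1) = A / (A + B) := by
      have h2 : 2 * g w + 1 = (A + B) / (B - A) := by
        rw [hgw]; field_simp; ring
      rw [h2, hgw]; field_simp
    rw [hgv]
    have hlt : A / (A + B) < 1 := by rw [div_lt_one hAB]; linarith
    have hge : 0 ≤ A / (A + B) := div_nonneg hA0 hAB.le
    have hglb : IsGLB ({β : ℝ | β ∈ Set.Ioo (0:ℝ) 1 ∧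
        ex β (fun ω => ∑ i, w i * X i ω) ≤ ∑ i, w i * x i} ∪ {1}) (A / (A + B)) := by
      constructor
      · rintro β (⟨hβ, h⟩ | h)
        · rw [hiff β hβ] at h
          rw [div_le_iff₀ hAB]; linarith
        · rw [Set.mem_singleton_iff] at h
          rw [h]; exact hlt.le
      · intro l hl
        apply le_of_forall_gt_imp_ge_of_dense
        intro b hb
        rcases lt_or_ge b 1 with h | h
        · apply hl
          left
          have hb' : b ∈ Set.Ioo (0:ℝ) 1 := ⟨by linarith, h⟩
          refine ⟨hb', (hiff b hb').2 ?_⟩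
          rw [div_lt_iff₀ hAB] at hb
          linarith
        · exact (hl (Or.inr rfl)).trans h
    rw [hglb.csInf_eq ⟨1, Or.inr rfl⟩]
    ring
  refine ⟨hpos, hDQ, fun w hw => ?_⟩
  refine forall₂_congr fun u hu => ?_
  rw [hDQ w hw, hDQ u hu, mul_le_mul_iff_right₀ (one_div_pos.2 hα.1)]
  have h1 := hg0 w hw
  have h2 := hg0 u hu
  rw [div_le_div_iff₀ (by linarith) (by linarith)]
  constructor <;> intro h <;> nlinarith
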